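/- arXiv:2108.10596 — 5 statements merged into one kernel-verified Lean document; each statement's English description precedes it below -/
import Mathlib

section
/- Let α ∈ (0,1), σ = 1 − α/2, T > 0, and let λ : [0,T] → ℝ be twice continuously differentiable with λ > 0 and λ' ≤ 0. Let k, q : [0,1] × [0,T] → ℝ be continuous with 0 < c₁ ≤ k(x,t) ≤ c₂ and q(x,t) ≥ 0. Let N ≥ 2, M ≥ 1 be integers, h = 1/N, τ = T/M, x_i = ih, t_j = jτ, t_{j+σ} = (j+σ)τ. Suppose the grid functions y^0, …, y^M : {0,…,N} → ℝ with y_0^j = y_N^j = 0 and right-hand sides φ^{j+σ} satisfy, for all 0 ≤ j ≤ M−1 and 1 ≤ i ≤ N−1, (τ^{1−α}/Γ(2−α)) Σ_{s=0}^{j} c_{j−s}^{(α)} (y_i^{s+1} − y_i^s)/τ = (a_{i+1}^{j+σ}(y_{i+1}^{(σ)} − y_i^{(σ)}) − a_i^{j+σ}(y_i^{(σ)} − y_{i−1}^{(σ)}))/h² − d_i^{j+σ} y_i^{(σ)} + φ_i^{j+σ}, where y^{(σ)} = σ y^{j+1} + (1−σ) y^j, a_i^{j+σ} = k(x_i − h/2,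 t_{j+σ}), d_i^{j+σ} = q(x_i, t_{j+σ}). Then for every 0 ≤ j ≤ M−1, ‖y^{j+1}‖₀² ≤ ‖y^0‖₀² + (T^α Γ(1−α) / (2 λ(T) c₁)) · max_{0 ≤ m ≤ M−1} ‖φ^{m+σ}‖₀². -/
/-- `a_l^{(α)}`: `a_0 = σ^{1−α}`, `a_l = (l+σ)^{1−α} − (l−1+σ)^{1−α}` for `l ≥ 1`. -/
noncomputable def aCoef (α σ : ℝ) (l : ℕ) : ℝ :=
  if l = 0 then σ ^ (1 - α)
  else ((l : ℝ) + σ) ^ (1 - α) - ((l : ℝ) - 1 + σ) ^ (1 - α)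

/-- `b_l^{(α)} = ((l+σ)^{2−α} − (l−1+σ)^{2−α})/(2−α) − ((l+σ)^{1−α} + (l−1+σ)^{1−α})/2` for `l ≥ 1`. -/
noncomputable def bCoef (α σ : ℝ) (l : ℕ) : ℝ :=
  (((l : ℝ) + σ) ^ (2 - α) - ((l : ℝ) - 1 + σ) ^ (2 - α)) / (2 - α) -
    (((l : ℝ) + σ) ^ (1 - α) + ((l : ℝ) - 1 + σ) ^ (1 - α)) / 2

/-- `c_s^{(α)}` for the `_λ`L2-1`_σ` formula at the level `j`, with weight `λ` sampled at
multiples of the time step `τ` (`λ_r = λ(rτ)`):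
if `j = 0`, `c_0 = λ_{σ−1/2} a_0`; if `j ≥ 1`, `c_0 = λ_{σ−1/2} a_0 + λ_σ b_1`,
`c_s = λ_{s+σ−1/2} a_s + λ_{s+σ} b_{s+1} − λ_{s+σ} b_s` for `1 ≤ s ≤ j−1`, and
`c_j = λ_{j+σ−1/2} a_j − λ_{j+σ} b_j`. -/
noncomputable def cCoef (α σ τ : ℝ) (lam : ℝ → ℝ) (j s : ℕ) : ℝ :=
  if j = 0 then lam ((σ - 1 / 2) * τ) * aCoef α σ 0
  else if s = 0 then lam ((σ - 1 / 2) * τ) * aCoef α σ 0 + lam (σ * τ) * bCoef α σ 1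
  else if s = j then
    lam (((j : ℝ) + σ - 1 / 2) * τ) * aCoef α σ j - lam (((j : ℝ) + σ) * τ) * bCoef α σ j
  else
    lam (((s : ℝ) + σ - 1 / 2) * τ) * aCoef α σ s + lam (((s : ℝ) + σ) * τ) * bCoef α σ (s + 1) -
      lam (((s : ℝ) + σ) * τ) * bCoef α σ s

/-- Grid inner product `(y, v) = Σ_{i=1}^{N−1} y_i v_i h` with `h = 1/N`. -/
noncomputable def gridInner (N : ℕ) (y v : ℕ → ℝ) : ℝ :=
  ∑ i ∈ Finset.Ioo 0 N, y i * v i * (1 / (N : ℝ))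

open Finset

/-- The trapezoidal rule overestimates the increment of a function with convex derivative. -/
lemma sub_le_trapezoid {G g : ℝ → ℝ} {x y : ℝ} (hxy : x < y)
    (hG : ∀ u ∈ Set.Icc x y, HasDerivAt G (g u) u) (hg : ConvexOn ℝ (Set.Icc x y) g) :
    G y - G x ≤ (y - x) * (g x + g y) / 2 := by
  have hpos : 0 < y - x := sub_pos.2 hxy
  set D : ℝ → ℝ := fun u =>
    G u - (g x * (u - x) + (g y - g x) / (y - x) * ((u - x) ^ 2 / 2)) with hD
  have hderiv : ∀ u ∈ Set.Icc x y,
      HasDerivAt D (g u - (g x + (g y - g x) / (y - x) * (u - x))) u := by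
    intro u hu
    have h1 : HasDerivAt (fun u => u - x) 1 u := (hasDerivAt_id u).sub_const x
    have h2 := (h1.const_mul (g x)).add (((h1.pow 2).div_const 2).const_mul ((g y - g x) / (y - x)))
    refine ((hG u hu).sub h2).congr_deriv ?_
    simp
  have hanti : AntitoneOn D (Set.Icc x y) := by
    refine antitoneOn_of_hasDerivWithinAt_nonpos (convex_Icc x y)
      (fun u hu => (hderiv u hu).continuousAt.continuousWithinAt)
      (fun u hu => (hderiv u (interior_subset hu)).hasDerivWithinAt) ?_
    intro u hu
    have hu' := interior_subset hu
    have h := hg.2 (Set.left_mem_Icc.2 hxy.le) (Set.right_mem_Icc.2 hxy.le)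
      (show 0 ≤ (y - u) / (y - x) from div_nonneg (by linarith [hu'.2]) hpos.le)
      (show 0 ≤ (u - x) / (y - x) from div_nonneg (by linarith [hu'.1]) hpos.le)
      (by field_simp; ring)
    simp only [smul_eq_mul] at h
    have e1 : (y - u) / (y - x) * x + (u - x) / (y - x) * y = u := by field_simp; ring
    have e2 : (y - u) / (y - x) * g x + (u - x) / (y - x) * g y
        = g x + (g y - g x) / (y - x) * (u - x) := by field_simp; ring
    rw [e1, e2] at h
    linarith
  have h := hanti (Set.left_mem_Icc.2 hxy.le) (Set.right_mem_Icc.2 hxy.le) hxy.le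
  simp only [hD, sub_self] at h
  have e : (g y - g x) / (y - x) * ((y - x) ^ 2 / 2) = (g y - g x) * (y - x) / 2 := by
    field_simp
  rw [e] at h
  linarith

lemma exists_rpow_add_one_sub_rpow_eq (p : ℝ) {x : ℝ} (hx : 0 < x) :
    ∃ c ∈ Set.Ioo x (x + 1), (x + 1) ^ p - x ^ p = p * c ^ (p - 1) := by
  have hd : ∀ u ∈ Set.Icc x (x + 1), HasDerivAt (fun u : ℝ => u ^ p) (p * u ^ (p - 1)) u :=
    fun u hu => Real.hasDerivAt_rpow_const (Or.inl (hx.trans_le hu.1).ne')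
  obtain ⟨c, hc, h⟩ := exists_hasDerivAt_eq_slope (fun u : ℝ => u ^ p)
    (fun u => p * u ^ (p - 1)) (lt_add_one x)
    (fun u hu => (hd u hu).continuousAt.continuousWithinAt)
    (fun u hu => hd u (Set.Ioo_subset_Icc_self hu))
  exact ⟨c, hc, by simpa using h.symm⟩

lemma rpow_add_one_sub_rpow_le {p x : ℝ} (hp : 0 < p) (hp1 : p < 1) (hx : 0 < x) :
    (x + 1) ^ p - x ^ p ≤ p * x ^ (p - 1) := by
  obtain ⟨c, hc, h⟩ := exists_rpow_add_one_sub_rpow_eq p hx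
  rw [h]
  exact mul_le_mul_of_nonneg_left
    (Real.rpow_le_rpow_of_nonpos hx hc.1.le (by linarith)) hp.le

lemma le_rpow_add_one_sub_rpow {p x : ℝ} (hp : 0 < p) (hp1 : p < 1) (hx : 0 < x) :
    p * (x + 1) ^ (p - 1) ≤ (x + 1) ^ p - x ^ p := by
  obtain ⟨c, hc, h⟩ := exists_rpow_add_one_sub_rpow_eq p hx
  rw [h]
  exact mul_le_mul_of_nonneg_left
    (Real.rpow_le_rpow_of_nonpos (hx.trans hc.1) hc.2.le (by linarith)) hp.le

/-- The integral of `u ↦ u ^ p` over `[x, x + 1]` minus its trapezoidal approximation. -/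
noncomputable def trapezoidDefect (p x : ℝ) : ℝ :=
  ((x + 1) ^ (p + 1) - x ^ (p + 1)) / (p + 1) - ((x + 1) ^ p + x ^ p) / 2

lemma hasDerivAt_rpow_div {p u : ℝ} (hp : 0 < p) (hu : 0 < u) :
    HasDerivAt (fun u : ℝ => u ^ (p + 1) / (p + 1)) (u ^ p) u := by
  have h := (Real.hasDerivAt_rpow_const (p := p + 1) (Or.inl hu.ne')).div_const (p + 1)
  refine h.congr_deriv ?_
  have : p + 1 ≠ 0 := by positivity
  rw [add_sub_cancel_right]
  field_simp

lemma trapezoidDefect_nonneg {p x : ℝ} (hp : 0 < p) (hp1 : p < 1) (hx : 0 < x) :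
    0 ≤ trapezoidDefect p x := by
  have h := sub_le_trapezoid (G := fun u => -(u ^ (p + 1) / (p + 1))) (g := fun u => -u ^ p)
    (lt_add_one x)
    (fun u hu => (hasDerivAt_rpow_div hp (hx.trans_le hu.1)).neg)
    (((Real.concaveOn_rpow hp.le hp1.le).subset
      (fun u hu => hx.le.trans hu.1) (convex_Icc _ _)).neg)
  simp only [trapezoidDefect, sub_div] at h ⊢
  linarith

lemma convexOn_rpow_of_nonpos {p : ℝ} (hp : p ≤ 0) :
    ConvexOn ℝ (Set.Ioi 0) fun x : ℝ => x ^ p := by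
  have hd : ∀ (r x : ℝ), 0 < x → HasDerivAt (fun x : ℝ => x ^ r) (r * x ^ (r - 1)) x :=
    fun r x hx => Real.hasDerivAt_rpow_const (Or.inl hx.ne')
  refine convexOn_of_hasDerivWithinAt2_nonneg (convex_Ioi 0)
    (f' := fun x => p * x ^ (p - 1)) (f'' := fun x => p * ((p - 1) * x ^ (p - 1 - 1)))
    (fun x hx => (hd p x hx).continuousAt.continuousWithinAt)
    (fun x hx => (hd p x (interior_subset hx)).hasDerivWithinAt)
    (fun x hx => ((hd (p - 1) x (interior_subset hx)).const_mul p).hasDerivWithinAt) ?_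
  intro x hx
  have hx' : 0 < x := interior_subset hx
  rw [← mul_assoc]
  exact mul_nonneg (by nlinarith) (Real.rpow_nonneg hx'.le _)

lemma rpow_trapezoid {p x : ℝ} (hp : 0 < p) (hp1 : p < 1) (hx : 0 < x) :
    (x + 1) ^ p - x ^ p ≤ (p * x ^ (p - 1) + p * (x + 1) ^ (p - 1)) / 2 := by
  have h := sub_le_trapezoid (G := fun u => u ^ p) (g := fun u => p * u ^ (p - 1))
    (lt_add_one x)
    (fun u hu => Real.hasDerivAt_rpow_const (Or.inl (hx.trans_le hu.1).ne'))
    (((convexOn_rpow_of_nonpos (by linarith : p - 1 ≤ 0)).subset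
      (fun u hu => hx.trans_le hu.1) (convex_Icc _ _)).smul hp.le)
  simpa using h

lemma hasDerivAt_trapezoidDefect {p x : ℝ} (hp : 0 < p) (hx : 0 < x) :
    HasDerivAt (trapezoidDefect p)
      ((x + 1) ^ p - x ^ p - (p * (x + 1) ^ (p - 1) + p * x ^ (p - 1)) / 2) x := by
  have h1 := (hasDerivAt_rpow_div hp (show 0 < x + 1 by linarith)).comp_add_const x 1
  have h2 := hasDerivAt_rpow_div hp hx
  have h3 := (Real.hasDerivAt_rpow_const (p := p)
    (Or.inl (show x + 1 ≠ 0 by linarith))).comp_add_const x 1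
  have h4 := Real.hasDerivAt_rpow_const (p := p) (Or.inl hx.ne')
  refine ((h1.sub h2).sub ((h3.add h4).div_const 2)).congr_of_eventuallyEq (.of_forall ?_)
  intro u
  simp [trapezoidDefect, sub_div]

lemma antitoneOn_trapezoidDefect {p : ℝ} (hp : 0 < p) (hp1 : p < 1) :
    AntitoneOn (trapezoidDefect p) (Set.Ioi 0) := by
  refine antitoneOn_of_hasDerivWithinAt_nonpos (convex_Ioi 0)
    (fun u hu => (hasDerivAt_trapezoidDefect hp hu).continuousAt.continuousWithinAt)
    (fun u hu => (hasDerivAt_trapezoidDefect hp (interior_subset hu)).hasDerivWithinAt) ?_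
  intro u hu
  linarith [rpow_trapezoid hp hp1 (interior_subset hu)]

lemma antitoneOn_rpow_diff_sub_trapezoidDefect {p : ℝ} (hp : 0 < p) (hp1 : p < 1) :
    AntitoneOn (fun x => (x + 1) ^ p - x ^ p - trapezoidDefect p x) (Set.Ioi 0) := by
  have hd : ∀ x : ℝ, 0 < x → HasDerivAt (fun x => (x + 1) ^ p - x ^ p - trapezoidDefect p x)
      (p * (x + 1) ^ (p - 1) - p * x ^ (p - 1) -
        ((x + 1) ^ p - x ^ p - (p * (x + 1) ^ (p - 1) + p * x ^ (p - 1)) / 2)) x := by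
    intro x hx
    have h3 := (Real.hasDerivAt_rpow_const (p := p)
      (Or.inl (show x + 1 ≠ 0 by linarith))).comp_add_const x 1
    have h4 := Real.hasDerivAt_rpow_const (p := p) (Or.inl hx.ne')
    exact (h3.sub h4).sub (hasDerivAt_trapezoidDefect hp hx)
  refine antitoneOn_of_hasDerivWithinAt_nonpos (convex_Ioi 0)
    (fun u hu => (hd u hu).continuousAt.continuousWithinAt)
    (fun u hu => (hd u (interior_subset hu)).hasDerivWithinAt) ?_
  intro u hu
  have hu' : 0 < u := interior_subset hu
  linarith [le_rpow_add_one_sub_rpow hp hp1 hu', rpow_add_one_sub_rpow_le hp hp1 hu']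

lemma le_rpow_diff_sub_trapezoidDefect {p x : ℝ} (hp : 0 < p) (hp1 : p < 1) (hx : 0 < x) :
    p / 2 * (x + 1) ^ (p - 1) ≤ (x + 1) ^ p - x ^ p - trapezoidDefect p x := by
  obtain ⟨c, hc, h⟩ := exists_rpow_add_one_sub_rpow_eq (p + 1) hx
  have hc' : c ^ p ≤ (x + 1) ^ p := Real.rpow_le_rpow (hx.trans hc.1).le hc.2.le hp.le
  have h1 := le_rpow_add_one_sub_rpow hp hp1 hx
  have : p + 1 ≠ 0 := by positivity
  rw [trapezoidDefect, h, add_sub_cancel_right, mul_div_cancel_left₀ _ this]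
  linarith

lemma aCoef_succ (α σ : ℝ) (l : ℕ) :
    aCoef α σ (l + 1) = (l + σ + 1) ^ (1 - α) - (l + σ) ^ (1 - α) := by
  simp only [aCoef, Nat.succ_ne_zero, if_false]
  push_cast
  ring_nf

lemma bCoef_succ (α σ : ℝ) (l : ℕ) :
    bCoef α σ (l + 1) = trapezoidDefect (1 - α) (l + σ) := by
  simp only [bCoef, trapezoidDefect]
  push_cast
  ring_nf

section Coefficients

variable {α σ : ℝ}

lemma bCoef_succ_nonneg (hα : α ∈ Set.Ioo (0 : ℝ) 1) (hσ : 0 < σ) (l : ℕ) :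
    0 ≤ bCoef α σ (l + 1) := by
  rw [bCoef_succ]
  exact trapezoidDefect_nonneg (by linarith [hα.2]) (by linarith [hα.1]) (by positivity)

lemma bCoef_antitone (hα : α ∈ Set.Ioo (0 : ℝ) 1) (hσ : 0 < σ) (l : ℕ) :
    bCoef α σ (l + 2) ≤ bCoef α σ (l + 1) := by
  rw [bCoef_succ, bCoef_succ]
  refine antitoneOn_trapezoidDefect (by linarith [hα.2]) (by linarith [hα.1]) ?_ ?_ ?_
  · exact Set.mem_Ioi.2 (by positivity)
  · exact Set.mem_Ioi.2 (by positivity)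
  · push_cast; linarith

lemma aCoef_nonneg (hα : α ∈ Set.Ioo (0 : ℝ) 1) (hσ : 0 < σ) (l : ℕ) : 0 ≤ aCoef α σ l := by
  cases l with
  | zero => simp only [aCoef, if_true]; positivity
  | succ l =>
    rw [aCoef_succ, sub_nonneg]
    exact Real.rpow_le_rpow (by positivity) (by linarith) (by linarith [hα.2])

lemma aCoef_sub_bCoef_antitone (hα : α ∈ Set.Ioo (0 : ℝ) 1) (hσ : 0 < σ) (l : ℕ) :
    aCoef α σ (l + 2) - bCoef α σ (l + 2) ≤ aCoef α σ (l + 1) - bCoef α σ (l + 1) := by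
  rw [bCoef_succ, bCoef_succ, aCoef_succ, aCoef_succ]
  refine antitoneOn_rpow_diff_sub_trapezoidDefect (p := 1 - α) (by linarith [hα.2])
    (by linarith [hα.1]) (a := l + σ) (b := (l + 1 : ℕ) + σ) ?_ ?_ ?_
  · exact Set.mem_Ioi.2 (by positivity)
  · exact Set.mem_Ioi.2 (by positivity)
  · push_cast; linarith

lemma le_aCoef_sub_bCoef (hα : α ∈ Set.Ioo (0 : ℝ) 1) (hσ : 0 < σ) (l : ℕ) :
    (1 - α) / 2 * (((l + 1 : ℕ) : ℝ) + σ) ^ (-α) ≤ aCoef α σ (l + 1) - bCoef α σ (l + 1) := by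
  rw [bCoef_succ, aCoef_succ]
  have h := le_rpow_diff_sub_trapezoidDefect (p := 1 - α) (x := l + σ) (by linarith [hα.2])
    (by linarith [hα.1]) (by positivity)
  convert h using 3
  · push_cast; ring
  · ring

lemma mul_aCoef_one_le (hα : α ∈ Set.Ioo (0 : ℝ) 1) (hσ : 0 < σ) :
    σ * aCoef α σ 1 ≤ (1 - α) * aCoef α σ 0 := by
  have h := rpow_add_one_sub_rpow_le (p := 1 - α) (x := σ) (by linarith [hα.2])
    (by linarith [hα.1]) hσ
  have h1 : aCoef α σ 1 = (σ + 1) ^ (1 - α) - σ ^ (1 - α) := by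
    simpa using aCoef_succ α σ 0
  rw [h1]
  calc σ * ((σ + 1) ^ (1 - α) - σ ^ (1 - α)) ≤ σ * ((1 - α) * σ ^ (1 - α - 1)) := by gcongr
    _ = (1 - α) * aCoef α σ 0 := by
      simp only [aCoef, if_true]
      rw [Real.rpow_sub_one hσ.ne']
      field_simp

variable {T τ : ℝ} {lam : ℝ → ℝ}

lemma cCoef_succ_succ_le (hα : α ∈ Set.Ioo (0 : ℝ) 1) (hσ : 1 / 2 < σ) (hτ : 0 < τ)
    (hpos : ∀ t ∈ Set.Icc (0 : ℝ) T, 0 < lam t) (hanti : AntitoneOn lam (Set.Icc 0 T))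
    {j s : ℕ} (hj : (j + σ) * τ ≤ T) (hs : s + 1 < j) :
    cCoef α σ τ lam j (s + 2) ≤ cCoef α σ τ lam j (s + 1) := by
  have hs0 : (0 : ℝ) ≤ s := s.cast_nonneg
  have hsj : (s : ℝ) + 2 ≤ j := by exact_mod_cast hs
  have hσ0 : 0 < σ := by linarith
  have hmem : ∀ r : ℝ, 0 ≤ r → r ≤ j + σ → r * τ ∈ Set.Icc 0 T := fun r h0 h1 =>
    ⟨by positivity, (mul_le_mul_of_nonneg_right h1 hτ.le).trans hj⟩
  have hle : ∀ r r' : ℝ, 0 ≤ r → r ≤ r' → r' ≤ j + σ → lam (r' * τ) ≤ lam (r * τ) :=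
    fun r r' h0 h1 h2 => hanti (hmem r h0 (h1.trans h2)) (hmem r' (h0.trans h1) h2)
      (mul_le_mul_of_nonneg_right h1 hτ.le)
  have ha1 := aCoef_nonneg hα hσ0 (s + 1)
  have ha2 := aCoef_nonneg hα hσ0 (s + 2)
  have hab := aCoef_sub_bCoef_antitone hα hσ0 s
  have l1 := mul_le_mul_of_nonneg_right
    (hle (s + 1 + σ - 1 / 2) (s + 1 + σ) (by linarith) (by linarith) (by linarith)) ha1
  have l2 := mul_le_mul_of_nonneg_right
    (hle (s + 1 + σ) (s + 2 + σ - 1 / 2) (by linarith) (by linarith) (by linarith)) ha2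
  have l3 := mul_le_mul_of_nonneg_left hab
    (hpos _ (hmem (s + 1 + σ) (by linarith) (by linarith))).le
  have p2 := (hpos _ (hmem (s + 2 + σ) (by linarith) (by linarith))).le
  have hc1 : cCoef α σ τ lam j (s + 1) = lam ((s + 1 + σ - 1 / 2) * τ) * aCoef α σ (s + 1) +
      lam ((s + 1 + σ) * τ) * bCoef α σ (s + 2) - lam ((s + 1 + σ) * τ) * bCoef α σ (s + 1) := by
    rw [cCoef, if_neg (by omega), if_neg (by omega), if_neg (by omega)]
    push_cast; rfl
  have hc2 : cCoef α σ τ lam j (s + 2) ≤ lam ((s + 2 + σ - 1 / 2) * τ) * aCoef α σ (s + 2) := by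
    rcases eq_or_ne (s + 2) j with h | h
    · rw [cCoef, if_neg (by omega), if_neg (by omega), if_pos h, ← h]
      push_cast
      linarith [mul_nonneg p2 (bCoef_succ_nonneg hα hσ0 (s + 1))]
    · rw [cCoef, if_neg (by omega), if_neg (by omega), if_neg h]
      push_cast
      linarith [mul_le_mul_of_nonneg_left (bCoef_antitone hα hσ0 (s + 1)) p2]
  linarith

lemma mul_cCoef_one_le (hα : α ∈ Set.Ioo (0 : ℝ) 1) (hσ : 1 / 2 < σ) (hτ : 0 < τ)
    (hpos : ∀ t ∈ Set.Icc (0 : ℝ) T, 0 < lam t) (hanti : AntitoneOn lam (Set.Icc 0 T))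
    {j : ℕ} (hj : (j + σ) * τ ≤ T) (hj1 : 1 ≤ j) :
    σ * cCoef α σ τ lam j 1 ≤ (1 - α) * cCoef α σ τ lam j 0 := by
  have hjr : (1 : ℝ) ≤ j := by exact_mod_cast hj1
  have hσ0 : 0 < σ := by linarith
  have hα1 : 0 < 1 - α := by linarith [hα.2]
  have hmem : ∀ r : ℝ, 0 ≤ r → r ≤ j + σ → r * τ ∈ Set.Icc 0 T := fun r h0 h1 =>
    ⟨by positivity, (mul_le_mul_of_nonneg_right h1 hτ.le).trans hj⟩
  have hle : ∀ r r' : ℝ, 0 ≤ r → r ≤ r' → r' ≤ j + σ → lam (r' * τ) ≤ lam (r * τ) :=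
    fun r r' h0 h1 h2 => hanti (hmem r h0 (h1.trans h2)) (hmem r' (h0.trans h1) h2)
      (mul_le_mul_of_nonneg_right h1 hτ.le)
  have p0 := (hpos _ (hmem (σ - 1 / 2) (by linarith) (by linarith))).le
  have p1 := (hpos _ (hmem σ (by linarith) (by linarith))).le
  have p2 := (hpos _ (hmem (1 + σ) (by linarith) (by linarith))).le
  have hc0 : lam ((σ - 1 / 2) * τ) * aCoef α σ 0 ≤ cCoef α σ τ lam j 0 := by
    rw [cCoef, if_neg (by omega), if_pos rfl]
    linarith [mul_nonneg p1 (bCoef_succ_nonneg hα hσ0 0)]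
  have hc1 : cCoef α σ τ lam j 1 ≤ lam ((1 + σ - 1 / 2) * τ) * aCoef α σ 1 := by
    rcases eq_or_ne 1 j with h | h
    · rw [cCoef, if_neg (by omega), if_neg (by omega), if_pos h, ← h]
      push_cast
      linarith [mul_nonneg p2 (bCoef_succ_nonneg hα hσ0 0)]
    · rw [cCoef, if_neg (by omega), if_neg (by omega), if_neg h]
      push_cast
      linarith [mul_le_mul_of_nonneg_left (bCoef_antitone hα hσ0 0) p2]
  have hl := hle (σ - 1 / 2) (1 + σ - 1 / 2) (by linarith) (by linarith) (by linarith)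
  calc σ * cCoef α σ τ lam j 1 ≤ σ * (lam ((1 + σ - 1 / 2) * τ) * aCoef α σ 1) := by gcongr
    _ ≤ σ * (lam ((σ - 1 / 2) * τ) * aCoef α σ 1) := by
      gcongr
      exact aCoef_nonneg hα hσ0 1
    _ = lam ((σ - 1 / 2) * τ) * (σ * aCoef α σ 1) := by ring
    _ ≤ lam ((σ - 1 / 2) * τ) * ((1 - α) * aCoef α σ 0) :=
      mul_le_mul_of_nonneg_left (mul_aCoef_one_le hα hσ0) p0
    _ = (1 - α) * (lam ((σ - 1 / 2) * τ) * aCoef α σ 0) := by ring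
    _ ≤ (1 - α) * cCoef α σ τ lam j 0 := by gcongr

lemma le_cCoef_self (hα : α ∈ Set.Ioo (0 : ℝ) 1) (hσ : 1 / 2 < σ) (hτ : 0 < τ)
    (hpos : ∀ t ∈ Set.Icc (0 : ℝ) T, 0 < lam t) (hanti : AntitoneOn lam (Set.Icc 0 T))
    {j : ℕ} (hj : (j + σ) * τ ≤ T) :
    lam T * ((1 - α) / 2 * (j + σ) ^ (-α)) ≤ cCoef α σ τ lam j j := by
  have hσ0 : 0 < σ := by linarith
  have hα1 : 0 < 1 - α := by linarith [hα.2]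
  have hj0 : (0 : ℝ) ≤ j := j.cast_nonneg
  have hmem : ∀ r : ℝ, 0 ≤ r → r ≤ j + σ → r * τ ∈ Set.Icc 0 T := fun r h0 h1 =>
    ⟨by positivity, (mul_le_mul_of_nonneg_right h1 hτ.le).trans hj⟩
  have hle : ∀ r r' : ℝ, 0 ≤ r → r ≤ r' → r' ≤ j + σ → lam (r' * τ) ≤ lam (r * τ) :=
    fun r r' h0 h1 h2 => hanti (hmem r h0 (h1.trans h2)) (hmem r' (h0.trans h1) h2)
      (mul_le_mul_of_nonneg_right h1 hτ.le)
  have hmemj := hmem (j + σ) (by linarith) le_rfl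
  have hTmem : T ∈ Set.Icc 0 T := ⟨hmemj.1.trans hmemj.2, le_rfl⟩
  have hT : lam T ≤ lam ((j + σ) * τ) := hanti hmemj hTmem hmemj.2
  have hhalf := hle (j + σ - 1 / 2) (j + σ) (by linarith) (by linarith) le_rfl
  cases j with
  | zero =>
    simp only [cCoef, if_true, aCoef]
    have e : σ ^ (1 - α) = σ * σ ^ (-α) := by
      rw [sub_eq_add_neg, Real.rpow_add hσ0, Real.rpow_one]
    simp only [Nat.cast_zero, zero_add] at hT hhalf ⊢
    rw [e]
    have hr : 0 < σ ^ (-α) := by positivity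
    have h1 : (1 - α) / 2 * σ ^ (-α) ≤ σ * σ ^ (-α) := by
      gcongr
      linarith [hα.1]
    exact mul_le_mul (hT.trans hhalf) h1 (by positivity)
      ((hpos _ hTmem).le.trans (hT.trans hhalf))
  | succ l =>
    rw [cCoef, if_neg (by omega), if_neg (by omega), if_pos rfl]
    have h1 := le_aCoef_sub_bCoef hα hσ0 l
    have h2 := mul_le_mul_of_nonneg_right hhalf (aCoef_nonneg hα hσ0 (l + 1))
    have h3 := mul_le_mul hT h1 (by positivity) (hpos _ hmemj).le
    linarith

lemma cCoef_succ_pos (hα : α ∈ Set.Ioo (0 : ℝ) 1) (hσ : 1 / 2 < σ) (hτ : 0 < τ)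
    (hpos : ∀ t ∈ Set.Icc (0 : ℝ) T, 0 < lam t) (hanti : AntitoneOn lam (Set.Icc 0 T))
    {j s : ℕ} (hj : (j + σ) * τ ≤ T) (hs : s < j) : 0 < cCoef α σ τ lam j (s + 1) := by
  obtain ⟨m, hm⟩ := Nat.exists_eq_add_of_lt hs
  induction m generalizing s with
  | zero =>
    have hj0 : (0 : ℝ) ≤ j := j.cast_nonneg
    have hσj : 0 < j + σ := by linarith
    have hT : T ∈ Set.Icc 0 T := ⟨(mul_pos hσj hτ).le.trans hj, le_rfl⟩
    have hα1 : 0 < 1 - α := by linarith [hα.2]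
    have h := le_cCoef_self hα hσ hτ hpos hanti hj
    have hs1 : s + 1 = j := by omega
    rw [hs1]
    exact lt_of_lt_of_le (mul_pos (hpos T hT) (by positivity)) h
  | succ m ih =>
    exact (ih (s := s + 1) (by omega) (by omega)).trans_le
      (cCoef_succ_succ_le hα hσ hτ hpos hanti hj (by omega))

lemma cCoef_succ_le (hα : α ∈ Set.Ioo (0 : ℝ) 1) (hσ : 1 / 2 < σ) (hασ : 1 - α ≤ σ) (hτ : 0 < τ)
    (hpos : ∀ t ∈ Set.Icc (0 : ℝ) T, 0 < lam t) (hanti : AntitoneOn lam (Set.Icc 0 T))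
    {j s : ℕ} (hj : (j + σ) * τ ≤ T) (hs : s < j) :
    cCoef α σ τ lam j (s + 1) ≤ cCoef α σ τ lam j s := by
  cases s with
  | zero =>
    have h1 := mul_cCoef_one_le hα hσ hτ hpos hanti hj hs
    have h2 := cCoef_succ_pos hα hσ hτ hpos hanti hj hs
    have hσ0 : 0 < σ := by linarith
    have hα1 : 0 < 1 - α := by linarith [hα.2]
    have h0 : 0 < cCoef α σ τ lam j 0 :=
      pos_of_mul_pos_right ((mul_pos hσ0 h2).trans_le h1) hα1.le
    exact le_of_mul_le_mul_left (h1.trans (mul_le_mul_of_nonneg_right hασ h0.le)) hσ0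
  | succ s => exact cCoef_succ_succ_le hα hσ hτ hpos hanti hj hs

lemma cCoef_pos (hα : α ∈ Set.Ioo (0 : ℝ) 1) (hσ : 1 / 2 < σ) (hασ : 1 - α ≤ σ) (hτ : 0 < τ)
    (hpos : ∀ t ∈ Set.Icc (0 : ℝ) T, 0 < lam t) (hanti : AntitoneOn lam (Set.Icc 0 T))
    {j s : ℕ} (hj : (j + σ) * τ ≤ T) (hs : s ≤ j) : 0 < cCoef α σ τ lam j s := by
  rcases hs.eq_or_lt with rfl | hs
  · have hj0 : (0 : ℝ) ≤ s := s.cast_nonneg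
    have hσj : 0 < s + σ := by linarith
    have hT : T ∈ Set.Icc 0 T := ⟨(mul_pos hσj hτ).le.trans hj, le_rfl⟩
    have hα1 : 0 < 1 - α := by linarith [hα.2]
    exact lt_of_lt_of_le (mul_pos (hpos T hT) (by positivity))
      (le_cCoef_self hα hσ hτ hpos hanti hj)
  · exact (cCoef_succ_pos hα hσ hτ hpos hanti hj hs).trans_le
      (cCoef_succ_le hα hσ hασ hτ hpos hanti hj hs)

end Coefficients

section Energy

/-- The discrete energy accumulated by a sum with positive nondecreasing weights dominates the
square of the sum. -/
lemma sq_sum_mul_sub_le {γ v : ℕ → ℝ} {n : ℕ} (hpos : ∀ s < n, 0 < γ s)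
    (hmono : ∀ s, s + 1 < n → γ s ≤ γ (s + 1)) {g : ℝ} (hg : 0 < g)
    (hlast : ∀ s, s + 1 = n → γ s ≤ g) :
    (∑ s ∈ range n, γ s * (v (s + 1) - v s)) ^ 2 ≤
      g * (2 * v n * ∑ s ∈ range n, γ s * (v (s + 1) - v s) -
        ∑ s ∈ range n, γ s * (v (s + 1) ^ 2 - v s ^ 2)) := by
  induction n generalizing g with
  | zero => simp
  | succ n ih =>
    have hγ := hpos n (Nat.lt_succ_self n)
    have h := ih (fun s hs => hpos s (by omega)) (fun s hs => hmono s (by omega)) hγ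
      (fun s hs => by subst hs; exact hmono s (by omega))
    rw [sum_range_succ, sum_range_succ]
    set S := ∑ s ∈ range n, γ s * (v (s + 1) - v s)
    set Q := ∑ s ∈ range n, γ s * (v (s + 1) ^ 2 - v s ^ 2)
    set P := 2 * v (n + 1) * (S + γ n * (v (n + 1) - v n)) -
      (Q + γ n * (v (n + 1) ^ 2 - v n ^ 2)) with hP
    have h1 : (S + γ n * (v (n + 1) - v n)) ^ 2 ≤ γ n * P := by
      rw [hP]; linear_combination h
    have hP0 : 0 ≤ P := nonneg_of_mul_nonneg_right ((sq_nonneg _).trans h1) hγ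
    exact h1.trans (mul_le_mul_of_nonneg_right (hlast n rfl) hP0)

lemma sum_mul_sq_sub_le {γ v : ℕ → ℝ} {j : ℕ} {σ : ℝ} (hσ : 1 / 2 < σ) (hσ1 : σ ≤ 1)
    (hpos : ∀ s ≤ j, 0 < γ s) (hmono : ∀ s, s + 1 < j → γ s ≤ γ (s + 1))
    (hlast : ∀ s, s + 1 = j → σ * γ s ≤ (2 * σ - 1) * γ j) :
    ∑ s ∈ range (j + 1), γ s * (v (s + 1) ^ 2 - v s ^ 2) ≤
      2 * ((σ * v (j + 1) + (1 - σ) * v j) *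
        ∑ s ∈ range (j + 1), γ s * (v (s + 1) - v s)) := by
  have hg : 0 < (2 * σ - 1) * γ j := mul_pos (by linarith) (hpos j le_rfl)
  have h := sq_sum_mul_sub_le (γ := γ) (v := v) (n := j) (fun s hs => hpos s hs.le) hmono
    (g := (2 * σ - 1) * γ j / σ) (by positivity)
    (fun s hs => by rw [le_div_iff₀ (by linarith)]; linarith [hlast s hs])
  rw [sum_range_succ, sum_range_succ]
  set S := ∑ s ∈ range j, γ s * (v (s + 1) - v s)
  set Q := ∑ s ∈ range j, γ s * (v (s + 1) ^ 2 - v s ^ 2)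
  set g := (2 * σ - 1) * γ j with hgdef
  set P := 2 * v j * S - Q with hP
  set δ := v (j + 1) - v j with hδ
  rw [div_mul_eq_mul_div, le_div_iff₀ (by linarith)] at h
  have h2 : (σ * S) ^ 2 ≤ g * P := by nlinarith [sq_nonneg S]
  have h3 : 0 ≤ P + 2 * σ * δ * S + g * δ ^ 2 := by
    refine nonneg_of_mul_nonneg_right (a := g) ?_ hg
    nlinarith [sq_nonneg (σ * S + g * δ)]
  rw [hP, hgdef, hδ] at h3
  rw [hδ]
  linear_combination h3

lemma le_add_of_sum_mul_sub_le {γ E : ℕ → ℝ} {j : ℕ} {B : ℝ} (hγ : 0 < γ j)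
    (hmono : ∀ s < j, γ s ≤ γ (s + 1)) (hE : ∀ s ≤ j, E s ≤ E 0 + B)
    (hsum : ∑ s ∈ range (j + 1), γ s * (E (s + 1) - E s) ≤ γ 0 * B) :
    E (j + 1) ≤ E 0 + B := by
  have key : ∀ n ≤ j, γ n * (E (n + 1) - (E 0 + B)) + γ 0 * B ≤
      ∑ s ∈ range (n + 1), γ s * (E (s + 1) - E s) := by
    intro n hn
    induction n with
    | zero => simp only [zero_add, range_one, sum_singleton]; linarith
    | succ n ih =>
      rw [sum_range_succ]
      have h1 := ih (by omega)
      have h2 := mul_nonneg (sub_nonneg.2 (hmono n (by omega))) (sub_nonneg.2 (hE (n + 1) hn))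
      linarith
  have h := (key j le_rfl).trans hsum
  have h' : γ j * (E (j + 1) - (E 0 + B)) ≤ 0 := by linarith
  linarith [nonpos_of_mul_nonpos_right h' hγ]

end Energy

section Space

lemma sum_mul_flux_eq {N : ℕ} (hN : 1 ≤ N) {w A : ℕ → ℝ} (h0 : w 0 = 0) (hw : w N = 0) :
    ∑ i ∈ Ioo 0 N, w i * (A (i + 1) * (w (i + 1) - w i) - A i * (w i - w (i - 1))) =
      -∑ i ∈ range N, A (i + 1) * (w (i + 1) - w i) ^ 2 := by
  obtain ⟨n, rfl⟩ : ∃ n, N = n + 1 := ⟨N - 1, by omega⟩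
  have key : ∀ m : ℕ, ∑ i ∈ range m, w (i + 1) *
      (A (i + 2) * (w (i + 2) - w (i + 1)) - A (i + 1) * (w (i + 1) - w i)) =
      w m * (A (m + 1) * (w (m + 1) - w m)) -
        ∑ i ∈ range m, A (i + 1) * (w (i + 1) - w i) ^ 2 - w 0 * (A 1 * (w 1 - w 0)) := by
    intro m
    induction m with
    | zero => simp
    | succ m ih => rw [sum_range_succ, ih, sum_range_succ _ m]; ring
  have hset : Ioo 0 (n + 1) = (range n).map (addRightEmbedding 1) := by
    ext i
    simp only [mem_Ioo, mem_map, mem_range, addRightEmbedding_apply]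
    exact ⟨fun h => ⟨i - 1, by omega, by omega⟩, fun ⟨a, ha, hi⟩ => by omega⟩
  rw [hset, sum_map]
  simp only [addRightEmbedding_apply, add_tsub_cancel_right]
  rw [key n, sum_range_succ, hw, h0]
  ring

/-- A discrete Poincaré inequality. -/
lemma sum_sq_le_sum_sq_sub {N : ℕ} {w : ℕ → ℝ} (h0 : w 0 = 0) :
    2 * ∑ i ∈ Ioo 0 N, w i ^ 2 ≤ (N : ℝ) ^ 2 * ∑ i ∈ range N, (w (i + 1) - w i) ^ 2 := by
  set D := ∑ i ∈ range N, (w (i + 1) - w i) ^ 2 with hD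
  have hD0 : 0 ≤ D := sum_nonneg fun i _ => sq_nonneg _
  have hpt : ∀ i ∈ range N, w i ^ 2 ≤ i * D := by
    intro i hi
    have h1 : w i = ∑ l ∈ range i, (w (l + 1) - w l) := by rw [sum_range_sub, h0, sub_zero]
    have h2 := sq_sum_le_card_mul_sum_sq (s := range i) (f := fun l => w (l + 1) - w l)
    rw [← h1, card_range] at h2
    refine h2.trans (mul_le_mul_of_nonneg_left ?_ i.cast_nonneg)
    exact sum_le_sum_of_subset_of_nonneg (range_subset_range.2 (mem_range.1 hi).le)
      fun _ _ _ => sq_nonneg _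
  have hsum : (∑ i ∈ range N, (i : ℝ)) * 2 ≤ (N : ℝ) ^ 2 := by
    have h : (∑ i ∈ range N, i) * 2 ≤ N ^ 2 := by
      rw [sum_range_id_mul_two, sq]
      exact Nat.mul_le_mul_left _ (Nat.sub_le _ _)
    have h' : (((∑ i ∈ range N, i) * 2 : ℕ) : ℝ) ≤ ((N ^ 2 : ℕ) : ℝ) := Nat.cast_le.2 h
    push_cast at h'
    exact h'
  have h3 : ∑ i ∈ Ioo 0 N, w i ^ 2 ≤ ∑ i ∈ range N, w i ^ 2 :=
    sum_le_sum_of_subset_of_nonneg (fun i hi => mem_range.2 (mem_Ioo.1 hi).2)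
      fun _ _ _ => sq_nonneg _
  have h4 := sum_le_sum hpt
  rw [← sum_mul] at h4
  nlinarith

lemma gridInner_le_of_flux_eq {N : ℕ} (hN : 1 ≤ N) {w A d f L : ℕ → ℝ} {c : ℝ} (hc : 0 < c)
    (h0 : w 0 = 0) (hw : w N = 0) (hA : ∀ i < N, c ≤ A (i + 1))
    (hd : ∀ i, 0 < i → i < N → 0 ≤ d i)
    (hL : ∀ i, 0 < i → i < N → L i =
      (A (i + 1) * (w (i + 1) - w i) - A i * (w i - w (i - 1))) / (1 / (N : ℝ)) ^ 2 -
        d i * w i + f i) :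
    gridInner N w L ≤ 1 / (8 * c) * gridInner N f f := by
  have hN0 : (0 : ℝ) < N := by exact_mod_cast hN
  have hpt : ∀ i ∈ Ioo 0 N, w i * L i ≤
      (N : ℝ) ^ 2 * (w i * (A (i + 1) * (w (i + 1) - w i) - A i * (w i - w (i - 1)))) +
        2 * c * w i ^ 2 + 1 / (8 * c) * f i ^ 2 := by
    intro i hi
    obtain ⟨hi0, hiN⟩ := mem_Ioo.1 hi
    rw [hL i hi0 hiN]
    have h1 : 0 ≤ d i * w i ^ 2 := mul_nonneg (hd i hi0 hiN) (sq_nonneg _)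
    have h2 : 0 ≤ 2 * c * (w i - f i / (4 * c)) ^ 2 := by positivity
    have e2 : 2 * c * (w i - f i / (4 * c)) ^ 2 =
        2 * c * w i ^ 2 + 1 / (8 * c) * f i ^ 2 - w i * f i := by field_simp; ring
    have e1 : ∀ X : ℝ, X / (1 / (N : ℝ)) ^ 2 = (N : ℝ) ^ 2 * X := fun X => by field_simp
    rw [e1]
    linarith
  have hsum := sum_le_sum hpt
  rw [sum_add_distrib, sum_add_distrib, ← mul_sum, ← mul_sum, ← mul_sum,
    sum_mul_flux_eq hN h0 hw] at hsum
  have hflux : c * ∑ i ∈ range N, (w (i + 1) - w i) ^ 2 ≤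
      ∑ i ∈ range N, A (i + 1) * (w (i + 1) - w i) ^ 2 := by
    rw [mul_sum]
    exact sum_le_sum fun i hi =>
      mul_le_mul_of_nonneg_right (hA i (mem_range.1 hi)) (sq_nonneg _)
  have h1 := mul_le_mul_of_nonneg_left hflux (sq_nonneg (N : ℝ))
  have h2 := mul_le_mul_of_nonneg_left (sum_sq_le_sum_sq_sub (N := N) h0) hc.le
  have h3 : ∑ i ∈ Ioo 0 N, w i * L i ≤ 1 / (8 * c) * ∑ i ∈ Ioo 0 N, f i ^ 2 := by linarith
  simp only [gridInner, ← sum_mul, ← sq, ← mul_assoc]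
  exact mul_le_mul_of_nonneg_right h3 (by positivity)

lemma gridInner_self_nonneg (N : ℕ) (v : ℕ → ℝ) : 0 ≤ gridInner N v v :=
  sum_nonneg fun i _ => mul_nonneg (mul_self_nonneg _) (by positivity)

lemma sum_mul_gridInner_sub_le {γ : ℕ → ℝ} {y : ℕ → ℕ → ℝ} {N j : ℕ} {σ : ℝ} (hσ : 1 / 2 < σ)
    (hσ1 : σ ≤ 1) (hpos : ∀ s ≤ j, 0 < γ s) (hmono : ∀ s, s + 1 < j → γ s ≤ γ (s + 1))
    (hlast : ∀ s, s + 1 = j → σ * γ s ≤ (2 * σ - 1) * γ j) :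
    ∑ s ∈ range (j + 1), γ s * (gridInner N (y (s + 1)) (y (s + 1)) - gridInner N (y s) (y s)) ≤
      2 * gridInner N (fun i => σ * y (j + 1) i + (1 - σ) * y j i)
        (fun i => ∑ s ∈ range (j + 1), γ s * (y (s + 1) i - y s i)) := by
  simp only [gridInner, ← sum_sub_distrib, mul_sum (Ioo 0 N)]
  rw [sum_comm]
  refine sum_le_sum fun i _ => ?_
  have h := sum_mul_sq_sub_le (γ := γ) (v := fun s => y s i) hσ hσ1 hpos hmono hlast
  have h' := mul_le_mul_of_nonneg_right h (show (0 : ℝ) ≤ 1 / (N : ℝ) by positivity)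
  rw [sum_mul] at h'
  calc _ = ∑ s ∈ range (j + 1), γ s * (y (s + 1) i ^ 2 - y s i ^ 2) * (1 / (N : ℝ)) :=
        sum_congr rfl fun s _ => by ring
    _ ≤ _ := h'
    _ = _ := by ring

end Space

/-- Theorem 4 of the paper (unconditional stability of scheme (23)–(24)):
for the second-order scheme for the generalized time-fractional diffusion equation with
variable coefficients, any solution satisfies the a priori estimate
`‖y^{j+1}‖₀² ≤ ‖y^0‖₀² + (T^α Γ(1−α)/(2λ(T)c₁)) max_m ‖φ^{m+σ}‖₀²`. -/
theorem statement14 (α σ T c₁ c₂ : ℝ) (hα : α ∈ Set.Ioo (0 : ℝ) 1) (hσ : σ = 1 - α / 2)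
    (hT : 0 < T) (hc₁ : 0 < c₁)
    (lam : ℝ → ℝ) (k q : ℝ → ℝ → ℝ)
    (hlam : ContDiffOn ℝ 2 lam (Set.Icc 0 T))
    (hlam_pos : ∀ t ∈ Set.Icc (0 : ℝ) T, 0 < lam t)
    (hlam_der : ∀ t ∈ Set.Icc (0 : ℝ) T, deriv lam t ≤ 0)
    (hk_cont : ContinuousOn (fun p : ℝ × ℝ => k p.1 p.2) (Set.Icc 0 1 ×ˢ Set.Icc 0 T))
    (hq_cont : ContinuousOn (fun p : ℝ × ℝ => q p.1 p.2) (Set.Icc 0 1 ×ˢ Set.Icc 0 T))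
    (hk : ∀ x ∈ Set.Icc (0 : ℝ) 1, ∀ t ∈ Set.Icc (0 : ℝ) T, c₁ ≤ k x t ∧ k x t ≤ c₂)
    (hq : ∀ x ∈ Set.Icc (0 : ℝ) 1, ∀ t ∈ Set.Icc (0 : ℝ) T, 0 ≤ q x t)
    (N M : ℕ) (hN : 2 ≤ N) (hM : 1 ≤ M)
    (y φ : ℕ → ℕ → ℝ)  -- `y j i = y_i^j`; `φ j i = φ_i^{j+σ}`
    (hy_bc : ∀ j, j ≤ M → y j 0 = 0 ∧ y j N = 0)
    (hscheme : ∀ j, j < M → ∀ i, 0 < i → i < N →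
      ((T / M) ^ (1 - α) / Real.Gamma (2 - α)) *
          ∑ s ∈ Finset.range (j + 1),
            cCoef α σ (T / M) lam j (j - s) * ((y (s + 1) i - y s i) / (T / M)) =
        (k (((i : ℝ) + 1) * (1 / N) - (1 / N) / 2) (((j : ℝ) + σ) * (T / M)) *
              ((σ * y (j + 1) (i + 1) + (1 - σ) * y j (i + 1)) -
                (σ * y (j + 1) i + (1 - σ) * y j i)) -
            k ((i : ℝ) * (1 / N) - (1 / N) / 2) (((j : ℝ) + σ) * (T / M)) *
              ((σ * y (j + 1) i + (1 - σ) * y j i) -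
                (σ * y (j + 1) (i - 1) + (1 - σ) * y j (i - 1)))) / (1 / N) ^ 2 -
          q ((i : ℝ) * (1 / N)) (((j : ℝ) + σ) * (T / M)) *
            (σ * y (j + 1) i + (1 - σ) * y j i) +
          φ j i) :
    ∀ j, j < M →
      gridInner N (y (j + 1)) (y (j + 1)) ≤
        gridInner N (y 0) (y 0) +
          (T ^ α * Real.Gamma (1 - α) / (2 * lam T * c₁)) *
            (Finset.range M).sup' (Finset.nonempty_range_iff.mpr (by omega))
              (fun m => gridInner N (φ m) (φ m)) := by
  have hα0 := hα.1
  have hα1 := hα.2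
  have hM0 : (0 : ℝ) < M := by exact_mod_cast hM
  have hσh : 1 / 2 < σ := by linarith
  have hσ1 : σ ≤ 1 := by linarith
  have hασ : 1 - α ≤ σ := by linarith
  have h2σ : 2 * σ - 1 = 1 - α := by linarith
  have hα1' : 0 < 1 - α := by linarith
  obtain ⟨τ, hτdef⟩ : ∃ τ : ℝ, τ = T / M := ⟨_, rfl⟩
  rw [← hτdef] at hscheme
  have hτ : 0 < τ := by rw [hτdef]; positivity
  have hτT : (M : ℝ) * τ = T := by rw [hτdef]; field_simp
  have hTmem : T ∈ Set.Icc 0 T := ⟨hT.le, le_rfl⟩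
  have hlamT := hlam_pos T hTmem
  have hanti : AntitoneOn lam (Set.Icc 0 T) :=
    antitoneOn_of_deriv_nonpos (convex_Icc 0 T) hlam.continuousOn
      ((hlam.differentiableOn (by norm_num)).mono interior_subset)
      fun t ht => hlam_der t (interior_subset ht)
  set Φ := (range M).sup' (nonempty_range_iff.mpr (by omega))
    (fun m => gridInner N (φ m) (φ m))
  have hΦ : ∀ m < M, gridInner N (φ m) (φ m) ≤ Φ := fun m hm =>
    le_sup' (fun m => gridInner N (φ m) (φ m)) (mem_range.2 hm)
  have hΦ0 : 0 ≤ Φ := (gridInner_self_nonneg N (φ 0)).trans (hΦ 0 (by omega))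
  have hΓ : 0 < Real.Gamma (1 - α) := Real.Gamma_pos_of_pos hα1'
  have hΓ2 : Real.Gamma (2 - α) = (1 - α) * Real.Gamma (1 - α) := by
    rw [← Real.Gamma_add_one hα1'.ne']
    ring_nf
  set K := T ^ α * Real.Gamma (1 - α) / (2 * lam T * c₁) with hK
  have hK0 : 0 ≤ K := by positivity
  intro j hj
  induction j using Nat.strong_induction_on with
  | _ j ih =>
  have hjM : (j : ℝ) + 1 ≤ M := by exact_mod_cast hj
  have hj0 : (0 : ℝ) ≤ j := j.cast_nonneg
  have hjσ : 0 < (j : ℝ) + σ := by linarith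
  have hjT : (j + σ) * τ ≤ T := by
    rw [← hτT]
    exact mul_le_mul_of_nonneg_right (by linarith) hτ.le
  have htmem : ((j : ℝ) + σ) * τ ∈ Set.Icc 0 T := ⟨by positivity, hjT⟩
  have hN0 : (0 : ℝ) < N := by exact_mod_cast (by omega : 0 < N)
  set γ : ℕ → ℝ := fun s => cCoef α σ τ lam j (j - s) with hγ
  have hγpos : ∀ s ≤ j, 0 < γ s := fun s _ =>
    cCoef_pos hα hσh hασ hτ hlam_pos hanti hjT (Nat.sub_le _ _)
  have hγmono : ∀ s < j, γ s ≤ γ (s + 1) := by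
    intro s hs
    have h := cCoef_succ_le hα hσh hασ hτ hlam_pos hanti hjT (s := j - (s + 1)) (by omega)
    rwa [show j - (s + 1) + 1 = j - s by omega] at h
  have hγlast : ∀ s, s + 1 = j → σ * γ s ≤ (2 * σ - 1) * γ j := by
    intro s hs
    have h := mul_cCoef_one_le hα hσh hτ hlam_pos hanti hjT (by omega)
    rw [h2σ]
    simp only [hγ, Nat.sub_self]
    rwa [show j - s = 1 by omega]
  refine le_add_of_sum_mul_sub_le (γ := γ) (E := fun s => gridInner N (y s) (y s))
    (hγpos j le_rfl) hγmono ?_ ?_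
  · intro s hs
    rcases s with _ | s
    · linarith [mul_nonneg hK0 hΦ0]
    · exact ih s (by omega) (by omega)
  set w : ℕ → ℝ := fun i => σ * y (j + 1) i + (1 - σ) * y j i with hw
  set S : ℕ → ℝ := fun i => ∑ s ∈ range (j + 1), γ s * (y (s + 1) i - y s i) with hS
  have henergy := sum_mul_gridInner_sub_le (N := N) (y := y) hσh hσ1 hγpos
    (fun s hs => hγmono s (by omega)) hγlast
  set C := τ ^ (1 - α) / Real.Gamma (2 - α) / τ with hC
  have hspace : gridInner N w (fun i => C * S i) ≤ 1 / (8 * c₁) * gridInner N (φ j) (φ j) := by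
    refine gridInner_le_of_flux_eq (by omega) hc₁ (w := w)
      (A := fun i => k ((i : ℝ) * (1 / N) - (1 / N) / 2) (((j : ℝ) + σ) * τ))
      (d := fun i => q ((i : ℝ) * (1 / N)) (((j : ℝ) + σ) * τ)) ?_ ?_ ?_ ?_ ?_
    · simp [hw, (hy_bc j hj.le).1, (hy_bc (j + 1) hj).1]
    · simp [hw, (hy_bc j hj.le).2, (hy_bc (j + 1) hj).2]
    · intro i hi
      have hiN : (i : ℝ) + 1 ≤ N := by exact_mod_cast hi
      have hi0 : (0 : ℝ) ≤ i := i.cast_nonneg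
      refine (hk _ ⟨?_, ?_⟩ _ htmem).1
      · push_cast
        have : ((i : ℝ) + 1) * (1 / N) - 1 / N / 2 = (i + 1 / 2) * (1 / N) := by ring
        rw [this]; positivity
      · push_cast
        have : ((i : ℝ) + 1) * (1 / N) - 1 / N / 2 = (i + 1 / 2) / N := by ring
        rw [this, div_le_one hN0]; linarith
    · intro i hi hiN
      have hiN : (i : ℝ) ≤ N := by exact_mod_cast hiN.le
      refine hq _ ⟨by positivity, ?_⟩ _ htmem
      rw [mul_one_div, div_le_one hN0]; exact hiN
    · intro i hi hiN
      have h := hscheme j hj i hi hiN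
      push_cast
      rw [← h, hC, hS]
      simp only [mul_div_assoc', ← sum_div]
      ring
  have hCS : gridInner N w (fun i => C * S i) = C * gridInner N w S := by
    simp only [gridInner, mul_sum]
    exact sum_congr rfl fun i _ => by ring
  rw [hCS] at hspace
  have hτα : τ ^ α ≤ T ^ α * (j + σ) ^ (-α) := by
    rw [Real.rpow_neg hjσ.le, ← div_eq_mul_inv, le_div_iff₀ (by positivity),
      ← Real.mul_rpow hτ.le hjσ.le, mul_comm τ]
    exact Real.rpow_le_rpow (by positivity) hjT hα0.le
  have hCinv : C * (τ ^ α * ((1 - α) * Real.Gamma (1 - α))) = 1 := by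
    rw [hC, hΓ2, Real.rpow_sub hτ, Real.rpow_one]
    have : τ ^ α ≠ 0 := by positivity
    field_simp
  have hγ0 : lam T * ((1 - α) / 2 * (j + σ) ^ (-α)) ≤ γ 0 :=
    le_cCoef_self hα hσh hτ hlam_pos hanti hjT
  have hγK : τ ^ α * ((1 - α) * Real.Gamma (1 - α)) * (1 / (4 * c₁)) ≤ γ 0 * K := by
    calc τ ^ α * ((1 - α) * Real.Gamma (1 - α)) * (1 / (4 * c₁))
        ≤ T ^ α * (j + σ) ^ (-α) * ((1 - α) * Real.Gamma (1 - α)) * (1 / (4 * c₁)) := by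
          gcongr
      _ = lam T * ((1 - α) / 2 * (j + σ) ^ (-α)) * K := by
          rw [hK]; field_simp; norm_num
      _ ≤ γ 0 * K := by gcongr
  calc _ ≤ 2 * gridInner N w S := henergy
    _ = 2 * (τ ^ α * ((1 - α) * Real.Gamma (1 - α))) * (C * gridInner N w S) := by
      linear_combination (-2 * gridInner N w S) * hCinv
    _ ≤ 2 * (τ ^ α * ((1 - α) * Real.Gamma (1 - α))) * (1 / (8 * c₁) * Φ) := by
      refine mul_le_mul_of_nonneg_left (hspace.trans ?_) (by positivity)
      exact mul_le_mul_of_nonneg_left (hΦ j hj) (by positivity)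
    _ = τ ^ α * ((1 - α) * Real.Gamma (1 - α)) * (1 / (4 * c₁)) * Φ := by field_simp; ring
    _ ≤ γ 0 * K * Φ := mul_le_mul_of_nonneg_right hγK hΦ0
    _ = γ 0 * (K * Φ) := by ring
end

section
/- Let N ≥ 2 be an integer, h = 1/N, and let y : {0,1,…,N} → ℝ be a grid function with y_0 = y_N = 0. Define (H_h y)_i = (y_{i−1} + 10 y_i + y_{i+1})/12 for 1 ≤ i ≤ N−1. Then (5/12) ‖y‖₀² ≤ ‖H_h y‖₀² ≤ ‖y‖₀². -/
/-- The compact averaging operator `(H_h v)_i = (v_{i−1} + 10 v_i + v_{i+1})/12`. -/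
noncomputable def Hh (v : ℕ → ℝ) (i : ℕ) : ℝ :=
  (v (i - 1) + 10 * v i + v (i + 1)) / 12

/-- A grid inner product as a sum over interior nodes indexed from zero. -/
lemma gridInner_succ (n : ℕ) (y v : ℕ → ℝ) :
    gridInner (n + 1) y v =
      (∑ i ∈ Finset.range n, y (i + 1) * v (i + 1)) * (1 / ((n + 1 : ℕ) : ℝ)) := by
  have h : Finset.Ioo 0 (n + 1) = Finset.Ico 1 (n + 1) := by
    ext i
    simp [Nat.one_le_iff_ne_zero, Nat.pos_iff_ne_zero]
  rw [gridInner, h, Finset.sum_Ico_eq_sum_range, Finset.sum_mul]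
  simp [add_comm 1]

lemma sum_sq_neighbors (y : ℕ → ℝ) (n : ℕ) :
    ∑ i ∈ Finset.range n, (y i ^ 2 + y (i + 2) ^ 2) =
      2 * ∑ i ∈ Finset.range n, y (i + 1) ^ 2
        + y 0 ^ 2 - y 1 ^ 2 + y (n + 1) ^ 2 - y n ^ 2 := by
  induction n with
  | zero => simp
  | succ n ih =>
    rw [Finset.sum_range_succ, Finset.sum_range_succ, ih]
    ring

/-- equivalence of the norms `‖H_h y‖₀` and `‖y‖₀`:
for any grid function `y` vanishing at `i = 0` and `i = N`,
`(5/12)‖y‖₀² ≤ ‖H_h y‖₀² ≤ ‖y‖₀²`. -/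
theorem statement16 (N : ℕ) (hN : 2 ≤ N) (y : ℕ → ℝ)
    (hy0 : y 0 = 0) (hyN : y N = 0) :
    (5 / 12) * gridInner N y y ≤ gridInner N (Hh y) (Hh y) ∧
      gridInner N (Hh y) (Hh y) ≤ gridInner N y y := by
  obtain ⟨n, rfl⟩ : ∃ n, N = n + 1 := ⟨N - 1, by omega⟩
  have hT : ∑ i ∈ Finset.range n, (y i ^ 2 + y (i + 2) ^ 2) ≤
      2 * ∑ i ∈ Finset.range n, y (i + 1) ^ 2 := by
    rw [sum_sq_neighbors, hy0, hyN]
    nlinarith [sq_nonneg (y 1), sq_nonneg (y n)]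
  have hS : 0 ≤ ∑ i ∈ Finset.range n, y (i + 1) ^ 2 :=
    Finset.sum_nonneg fun i _ => sq_nonneg _
  have hlow : 5 / 9 * ∑ i ∈ Finset.range n, y (i + 1) ^ 2
      - 1 / 18 * ∑ i ∈ Finset.range n, (y i ^ 2 + y (i + 2) ^ 2) ≤
      ∑ i ∈ Finset.range n, Hh y (i + 1) ^ 2 := by
    rw [Finset.mul_sum, Finset.mul_sum, ← Finset.sum_sub_distrib]
    refine Finset.sum_le_sum fun i _ => ?_
    simp only [Hh, Nat.add_sub_cancel, add_assoc, Nat.reduceAdd]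
    nlinarith [sq_nonneg ((y i + 10 * y (i + 1) + y (i + 2)) / 12 - 2 / 3 * y (i + 1)),
      sq_nonneg (y i + y (i + 1)), sq_nonneg (y (i + 2) + y (i + 1))]
  have hup : ∑ i ∈ Finset.range n, Hh y (i + 1) ^ 2 ≤
      5 / 6 * ∑ i ∈ Finset.range n, y (i + 1) ^ 2
      + 1 / 12 * ∑ i ∈ Finset.range n, (y i ^ 2 + y (i + 2) ^ 2) := by
    rw [Finset.mul_sum, Finset.mul_sum, ← Finset.sum_add_distrib]
    refine Finset.sum_le_sum fun i _ => ?_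
    simp only [Hh, Nat.add_sub_cancel, add_assoc, Nat.reduceAdd]
    nlinarith [sq_nonneg (y i - y (i + 1)), sq_nonneg (y (i + 2) - y (i + 1)),
      sq_nonneg (y i - y (i + 2))]
  have hh : (0 : ℝ) ≤ 1 / ((n + 1 : ℕ) : ℝ) := by positivity
  simp only [gridInner_succ, ← pow_two, ← mul_assoc]
  constructor <;> refine mul_le_mul_of_nonneg_right ?_ hh <;> linarith
end

section
/- Let N ≥ 2 be an integer, h = 1/N, and let y : {0,1,…,N} → ℝ be a grid function with y_0 = y_N = 0. Define (H_h y)_i = (y_{i−1} + 10 y_i + y_{i+1})/12 and the second difference (y_{x̄x})_i = (y_{i+1} − 2 y_i + y_{i−1})/h² for 1 ≤ i ≤ N−1, and the backward difference (y_{x̄})_i = (y_i − y_{i−1})/h for 1 ≤ i ≤ N. Then −(H_h y, y_{x̄x}) ≥ (2/3) Σ_{i=1}^{N} (y_{x̄,i})² h ≥ (8/3) ‖y‖₀². -/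
/-- Summation by parts for `-(H_h y, y_{x̄x})` (up to scaling), with boundary terms kept. -/
theorem sum_neg_Hh_mul_secondDiff_ge (y : ℕ → ℝ) (n : ℕ) :
    (2 / 3) * ∑ k ∈ Finset.range n, (y (k + 1) - y k) ^ 2
        + (y 0 * (y 1 - y 0) + (y 1 - y 0) ^ 2 / 6)
        - (y n * (y (n + 1) - y n) + (y (n + 1) - y n) ^ 2 / 6) ≤
      ∑ k ∈ Finset.range n, -(Hh y (k + 1) * (y (k + 2) - 2 * y (k + 1) + y k)) := by
  induction n with
  | zero => simp
  | succ n ih =>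
    rw [Finset.sum_range_succ, Finset.sum_range_succ]
    simp only [Hh, Nat.add_sub_cancel] at ih ⊢
    rw [show n + 1 + 1 = n + 2 from rfl]
    nlinarith [sq_nonneg (y (n + 2) - y n)]

/-- A discrete Sobolev inequality: the maximum is controlled by the first differences. -/
theorem four_mul_sq_le_sum_sq_diff (y : ℕ → ℝ) {N i : ℕ} (hi : i ≤ N)
    (hy0 : y 0 = 0) (hyN : y N = 0) :
    4 * y i ^ 2 ≤ N * ∑ k ∈ Finset.range N, (y (k + 1) - y k) ^ 2 := by
  have hleft : |y i| ≤ ∑ k ∈ Finset.range i, |y (k + 1) - y k| := by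
    have h := Finset.abs_sum_le_sum_abs (fun k => y (k + 1) - y k) (Finset.range i)
    rwa [Finset.sum_range_sub, hy0, sub_zero] at h
  have hright : |y i| ≤ ∑ k ∈ Finset.Ico i N, |y (k + 1) - y k| := by
    have h := Finset.abs_sum_le_sum_abs (fun k => y (k + 1) - y k) (Finset.Ico i N)
    rwa [Finset.sum_Ico_sub y hi, hyN, zero_sub, abs_neg] at h
  have hsum := Finset.sum_range_add_sum_Ico (fun k => |y (k + 1) - y k|) hi
  have hcs := sq_sum_le_card_mul_sum_sq (s := Finset.range N) (f := fun k => |y (k + 1) - y k|)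
  simp only [Finset.card_range, sq_abs] at hcs
  calc 4 * y i ^ 2 = (2 * |y i|) ^ 2 := by rw [mul_pow, sq_abs]; norm_num
    _ ≤ (∑ k ∈ Finset.range N, |y (k + 1) - y k|) ^ 2 := by
      gcongr
      linarith
    _ ≤ _ := hcs

/-- A discrete Poincaré inequality. -/
theorem four_mul_sum_sq_le_sum_sq_diff (y : ℕ → ℝ) (n : ℕ)
    (hy0 : y 0 = 0) (hyN : y (n + 1) = 0) :
    4 * ∑ k ∈ Finset.range n, y (k + 1) ^ 2 ≤
      ((n : ℝ) + 1) ^ 2 * ∑ k ∈ Finset.range (n + 1), (y (k + 1) - y k) ^ 2 := by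
  set S := ∑ k ∈ Finset.range (n + 1), (y (k + 1) - y k) ^ 2
  have hS : 0 ≤ S := Finset.sum_nonneg fun _ _ => sq_nonneg _
  have h : ∑ k ∈ Finset.range n, 4 * y (k + 1) ^ 2 ≤
      ∑ _k ∈ Finset.range n, ((n : ℝ) + 1) * S := by
    refine Finset.sum_le_sum fun k hk => ?_
    have hk' := Finset.mem_range.mp hk
    exact_mod_cast four_mul_sq_le_sum_sq_diff y (by lia : k + 1 ≤ n + 1) hy0 hyN
  rw [← Finset.mul_sum, Finset.sum_const, Finset.card_range, nsmul_eq_mul] at h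
  have : 0 ≤ ((n : ℝ) + 1) * S := by positivity
  nlinarith

theorem sum_Ioo_zero_succ (f : ℕ → ℝ) (n : ℕ) :
    ∑ i ∈ Finset.Ioo 0 (n + 1), f i = ∑ k ∈ Finset.range n, f (k + 1) := by
  rw [Finset.range_eq_Ico, Finset.sum_Ico_add' f 0 n 1]
  rfl

theorem sum_Icc_one (f : ℕ → ℝ) (n : ℕ) :
    ∑ i ∈ Finset.Icc 1 n, f i = ∑ k ∈ Finset.range n, f (k + 1) := by
  rw [Finset.range_eq_Ico, Finset.sum_Ico_add' f 0 n 1]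
  rfl

/-- the key estimate used in the proof of Theorem 5:
for any grid function `y` vanishing at `i = 0` and `i = N`, with
`(y_{x̄x})_i = (y_{i+1} − 2y_i + y_{i−1})/h²` and `(y_{x̄})_i = (y_i − y_{i−1})/h`,
`−(H_h y, y_{x̄x}) ≥ (2/3) Σ_{i=1}^{N} (y_{x̄,i})² h ≥ (8/3)‖y‖₀²`. -/
theorem statement17 (N : ℕ) (hN : 2 ≤ N) (y : ℕ → ℝ)
    (hy0 : y 0 = 0) (hyN : y N = 0) :
    -(gridInner N (Hh y)
        (fun i => (y (i + 1) - 2 * y i + y (i - 1)) / (1 / (N : ℝ)) ^ 2)) ≥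
      (2 / 3) * ∑ i ∈ Finset.Icc 1 N, ((y i - y (i - 1)) / (1 / (N : ℝ))) ^ 2 * (1 / (N : ℝ)) ∧
    (2 / 3) * (∑ i ∈ Finset.Icc 1 N, ((y i - y (i - 1)) / (1 / (N : ℝ))) ^ 2 * (1 / (N : ℝ))) ≥
      (8 / 3) * gridInner N y y := by
  obtain ⟨n, rfl⟩ : ∃ n, N = n + 1 := ⟨N - 1, by lia⟩
  have hpos : (0 : ℝ) < (n : ℝ) + 1 := by positivity
  have hD : ∑ i ∈ Finset.Icc 1 (n + 1),
      ((y i - y (i - 1)) / (1 / ((n + 1 : ℕ) : ℝ))) ^ 2 * (1 / ((n + 1 : ℕ) : ℝ)) =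
      ((n : ℝ) + 1) * ∑ k ∈ Finset.range (n + 1), (y (k + 1) - y k) ^ 2 := by
    rw [sum_Icc_one, Finset.mul_sum]
    refine Finset.sum_congr rfl fun k _ => ?_
    rw [Nat.add_sub_cancel]
    push_cast
    field_simp
  rw [hD]
  constructor
  · have hH : -(gridInner (n + 1) (Hh y)
        (fun i => (y (i + 1) - 2 * y i + y (i - 1)) / (1 / ((n + 1 : ℕ) : ℝ)) ^ 2)) =
        ((n : ℝ) + 1) * ∑ k ∈ Finset.range n,
          -(Hh y (k + 1) * (y (k + 2) - 2 * y (k + 1) + y k)) := by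
      rw [gridInner, sum_Ioo_zero_succ, Finset.mul_sum, ← Finset.sum_neg_distrib]
      refine Finset.sum_congr rfl fun k _ => ?_
      rw [Nat.add_sub_cancel]
      push_cast
      field_simp
    have hsum := sum_neg_Hh_mul_secondDiff_ge y n
    rw [hy0, hyN] at hsum
    rw [hH, Finset.sum_range_succ, hyN, ge_iff_le, mul_left_comm]
    gcongr
    nlinarith [sq_nonneg (y 1 - 0)]
  · have hG : gridInner (n + 1) y y =
        (∑ k ∈ Finset.range n, y (k + 1) ^ 2) / ((n : ℝ) + 1) := by
      rw [gridInner, sum_Ioo_zero_succ, Finset.sum_div]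
      refine Finset.sum_congr rfl fun k _ => ?_
      push_cast
      ring
    have hP := four_mul_sum_sq_le_sum_sq_diff y n hy0 hyN
    rw [hG, ge_iff_le, ← mul_div_assoc, div_le_iff₀ hpos]
    linarith
end

section
/- For all α ∈ (0,1), with σ = 1 − α/2, and all integers s ≥ 1, one has b_s^{(α)} = (α(1−α)/2^{2−α}) ∫_0^1 η ( ∫_{2(s+σ)−1−η}^{2(s+σ)−1+η} ξ^{−(α+1)} dξ ) dη. -/
theorem integral_rpow_neg_add_one_symm {α m η : ℝ} (hα : α ≠ 0) (hη : 0 ≤ η) (hm : η < m) :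
    ∫ ξ in (m - η)..(m + η), ξ ^ (-(α + 1)) = ((m - η) ^ (-α) - (m + η) ^ (-α)) / α := by
  rw [integral_rpow]
  · rw [show -(α + 1) + 1 = -α by ring, div_neg, ← neg_div, neg_sub]
  · refine Or.inr ⟨fun h => hα (by linarith), ?_⟩
    rw [Set.uIcc_of_le (by linarith)]
    exact fun h => by linarith [h.1]

theorem hasDerivAt_add_rpow {m η : ℝ} (p : ℝ) (h : 0 < m + η) :
    HasDerivAt (fun x : ℝ => (m + x) ^ p) (p * (m + η) ^ (p - 1)) η := by
  simpa using ((hasDerivAt_id η).const_add m).rpow_const (p := p) (Or.inl h.ne')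

theorem hasDerivAt_sub_rpow {m η : ℝ} (p : ℝ) (h : 0 < m - η) :
    HasDerivAt (fun x : ℝ => (m - x) ^ p) (-(p * (m - η) ^ (p - 1))) η := by
  simpa using ((hasDerivAt_id η).const_sub m).rpow_const (p := p) (Or.inl h.ne')

theorem integral_mul_sub_rpow_neg {α m : ℝ} (h1 : α ≠ 1) (h2 : α ≠ 2) (hm : 1 < m) :
    ∫ η in (0 : ℝ)..1, η * ((m - η) ^ (-α) - (m + η) ^ (-α)) =
      ((m + 1) ^ (2 - α) - (m - 1) ^ (2 - α)) / ((1 - α) * (2 - α)) -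
        ((m + 1) ^ (1 - α) + (m - 1) ^ (1 - α)) / (1 - α) := by
  have h1' : 1 - α ≠ 0 := sub_ne_zero.mpr h1.symm
  have h2' : 2 - α ≠ 0 := sub_ne_zero.mpr h2.symm
  have hpos : ∀ η ∈ Set.uIcc (0 : ℝ) 1, 0 < m - η ∧ 0 < m + η := by
    intro η hη
    rw [Set.uIcc_of_le zero_le_one] at hη
    exact ⟨by linarith [hη.2], by linarith [hη.1]⟩
  rw [intervalIntegral.integral_eq_sub_of_hasDerivAt
    (f := fun η : ℝ => ((m + η) ^ (2 - α) - (m - η) ^ (2 - α)) / ((1 - α) * (2 - α)) -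
        η * ((m + η) ^ (1 - α) + (m - η) ^ (1 - α)) / (1 - α))]
  · simp
  · intro η hη
    obtain ⟨hsub, hadd⟩ := hpos η hη
    have hd := (((hasDerivAt_add_rpow (2 - α) hadd).sub
      (hasDerivAt_sub_rpow (2 - α) hsub)).div_const ((1 - α) * (2 - α))).sub
      (((hasDerivAt_id η).mul ((hasDerivAt_add_rpow (1 - α) hadd).add
        (hasDerivAt_sub_rpow (1 - α) hsub))).div_const (1 - α))
    refine hd.congr_deriv ?_
    rw [show 2 - α - 1 = 1 - α by ring, show 1 - α - 1 = -α by ring]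
    simp only [id, Pi.add_apply]
    field_simp
    ring
  · refine ContinuousOn.intervalIntegrable fun η hη => ?_
    obtain ⟨hsub, hadd⟩ := hpos η hη
    exact (continuousAt_id.mul ((hasDerivAt_sub_rpow (-α) hsub).continuousAt.sub
      (hasDerivAt_add_rpow (-α) hadd).continuousAt)).continuousWithinAt

/-- the integral representation of `b_s^{(α)}` from the proof of Lemma 3:
for `α ∈ (0,1)`, `σ = 1 − α/2`, and integers `s ≥ 1`,
`b_s^{(α)} = (α(1−α)/2^{2−α}) ∫_0^1 η (∫_{2(s+σ)−1−η}^{2(s+σ)−1+η} ξ^{−(α+1)} dξ) dη`. -/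
theorem statement18 (α σ : ℝ) (hα : α ∈ Set.Ioo (0 : ℝ) 1) (hσ : σ = 1 - α / 2)
    (s : ℕ) (hs : 1 ≤ s) :
    bCoef α σ s =
      (α * (1 - α) / 2 ^ (2 - α)) *
        ∫ η in (0 : ℝ)..1,
          η * ∫ ξ in (2 * ((s : ℝ) + σ) - 1 - η)..(2 * ((s : ℝ) + σ) - 1 + η),
            ξ ^ (-(α + 1)) := by
  obtain ⟨h0, h1⟩ := hα
  have hs' : (1 : ℝ) ≤ s := by exact_mod_cast hs
  have hm : 1 < 2 * ((s : ℝ) + σ) - 1 := by linarith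
  have hinner : ∀ η ∈ Set.uIcc (0 : ℝ) 1,
      (η * ∫ ξ in (2 * ((s : ℝ) + σ) - 1 - η)..(2 * ((s : ℝ) + σ) - 1 + η), ξ ^ (-(α + 1))) =
        η * ((2 * ((s : ℝ) + σ) - 1 - η) ^ (-α) - (2 * ((s : ℝ) + σ) - 1 + η) ^ (-α)) / α := by
    intro η hη
    rw [Set.uIcc_of_le zero_le_one] at hη
    rw [integral_rpow_neg_add_one_symm h0.ne' hη.1 (by linarith [hη.2]), mul_div_assoc]
  rw [intervalIntegral.integral_congr hinner, intervalIntegral.integral_div,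
    integral_mul_sub_rpow_neg h1.ne (by linarith) hm,
    show 2 * ((s : ℝ) + σ) - 1 + 1 = 2 * (s + σ) by ring,
    show 2 * ((s : ℝ) + σ) - 1 - 1 = 2 * (s - 1 + σ) by ring]
  have ha : 0 ≤ (s : ℝ) + σ := by linarith
  have hb : 0 ≤ (s : ℝ) - 1 + σ := by linarith
  have h1' : 1 - α ≠ 0 := by linarith
  have h2' : 2 - α ≠ 0 := by linarith
  have hpow : (2 : ℝ) ^ (2 - α) = 2 * 2 ^ (1 - α) := by
    rw [show 2 - α = 1 + (1 - α) by ring, Real.rpow_add two_pos, Real.rpow_one]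
  have hne : (2 : ℝ) ^ (1 - α) ≠ 0 := (Real.rpow_pos_of_pos two_pos _).ne'
  rw [bCoef, Real.mul_rpow zero_le_two ha, Real.mul_rpow zero_le_two hb,
    Real.mul_rpow zero_le_two ha, Real.mul_rpow zero_le_two hb, hpow]
  field_simp
end

section
/- Let α ∈ (0,1), σ > 0, τ > 0, and j ≥ 0 an integer; set t_j = jτ, t_{j+1/2} = (j + 1/2)τ, and t_{j+σ} = (j+σ)τ. Then ∫_{t_j}^{t_{j+σ}} (η − t_{j+1/2}) (t_{j+σ} − η)^{−α} dη = σ^{1−α} τ^{2−α} (σ − 1 + α/2) / ((1−α)(2−α)). In particular, this integral vanishes precisely when σ = 1 − α/2. -/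
/-- The first moment, about an arbitrary point `m`, of the weakly singular kernel `(b - x) ^ r`. -/
lemma integral_sub_mul_sub_rpow {a b r : ℝ} (m : ℝ) (hab : a ≤ b) (hr : -1 < r) :
    ∫ x in a..b, (x - m) * (b - x) ^ r =
      (b - m) * ((b - a) ^ (r + 1) / (r + 1)) - (b - a) ^ (r + 2) / (r + 2) := by
  have hsub : ∫ x in a..b, (x - m) * (b - x) ^ r =
      ∫ u in (0 : ℝ)..(b - a), (b - u - m) * u ^ r := by
    simpa using intervalIntegral.integral_comp_sub_left
      (a := a) (b := b) (fun u : ℝ => (b - u - m) * u ^ r) b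
  have hsplit : ∫ u in (0 : ℝ)..(b - a), (b - u - m) * u ^ r =
      ∫ u in (0 : ℝ)..(b - a), ((b - m) * u ^ r - u ^ (r + 1)) := by
    refine intervalIntegral.integral_congr fun u hu => ?_
    rw [Set.uIcc_of_le (sub_nonneg.2 hab)] at hu
    have hpow : u ^ (r + 1) = u ^ r * u := Real.rpow_add_one' hu.1 (by linarith)
    simp only [hpow]
    ring
  rw [hsub, hsplit, intervalIntegral.integral_sub
    ((intervalIntegral.intervalIntegrable_rpow' hr).const_mul _)
    (intervalIntegral.intervalIntegrable_rpow' (by linarith)),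
    intervalIntegral.integral_const_mul, integral_rpow (Or.inl hr),
    integral_rpow (Or.inl (by linarith)), Real.zero_rpow (by linarith),
    Real.zero_rpow (by linarith), show r + 1 + 1 = r + 2 by ring]
  simp only [sub_zero]

/-- the exact value of the moment integral appearing in the truncation-error
analysis: for `α ∈ (0,1)`, `σ > 0`, `τ > 0`, `j ≥ 0`, with `t_s = sτ`,
`∫_{t_j}^{t_{j+σ}} (η − t_{j+1/2})(t_{j+σ} − η)^{−α} dη
  = σ^{1−α} τ^{2−α} (σ − 1 + α/2)/((1−α)(2−α))`;
in particular the integral vanishes iff `σ = 1 − α/2`. -/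
theorem statement19 (α σ τ : ℝ) (hα : α ∈ Set.Ioo (0 : ℝ) 1) (hσ : 0 < σ)
    (hτ : 0 < τ) (j : ℕ) :
    (∫ η in ((j : ℝ) * τ)..(((j : ℝ) + σ) * τ),
        (η - ((j : ℝ) + 1 / 2) * τ) * (((j : ℝ) + σ) * τ - η) ^ (-α)) =
      σ ^ (1 - α) * τ ^ (2 - α) * (σ - 1 + α / 2) / ((1 - α) * (2 - α)) ∧
    ((∫ η in ((j : ℝ) * τ)..(((j : ℝ) + σ) * τ),
        (η - ((j : ℝ) + 1 / 2) * τ) * (((j : ℝ) + σ) * τ - η) ^ (-α)) = 0 ↔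
      σ = 1 - α / 2) := by
  obtain ⟨hα0, hα1⟩ := hα
  have h1 : 1 - α ≠ 0 := by linarith
  have h2 : 2 - α ≠ 0 := by linarith
  have hval : (∫ η in ((j : ℝ) * τ)..(((j : ℝ) + σ) * τ),
        (η - ((j : ℝ) + 1 / 2) * τ) * (((j : ℝ) + σ) * τ - η) ^ (-α)) =
      σ ^ (1 - α) * τ ^ (2 - α) * (σ - 1 + α / 2) / ((1 - α) * (2 - α)) := by
    have hστ : 0 < σ * τ := mul_pos hσ hτ
    have hτpow : τ ^ (2 - α) = τ ^ (1 - α) * τ := by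
      rw [← Real.rpow_add_one hτ.ne']
      ring_nf
    have hστpow : (σ * τ) ^ (2 - α) = σ ^ (1 - α) * τ ^ (1 - α) * (σ * τ) := by
      rw [← Real.mul_rpow hσ.le hτ.le, ← Real.rpow_add_one hστ.ne']
      ring_nf
    rw [integral_sub_mul_sub_rpow _ (by linarith) (by linarith),
      show ((j : ℝ) + σ) * τ - j * τ = σ * τ by ring, show -α + 1 = 1 - α by ring,
      show -α + 2 = 2 - α by ring, hστpow, hτpow, Real.mul_rpow hσ.le hτ.le]
    field_simp
    ring
  refine ⟨hval, ?_⟩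
  have hσpow : σ ^ (1 - α) ≠ 0 := (Real.rpow_pos_of_pos hσ _).ne'
  have hτpow : τ ^ (2 - α) ≠ 0 := (Real.rpow_pos_of_pos hτ _).ne'
  rw [hval, div_eq_zero_iff, or_iff_left (mul_ne_zero h1 h2), mul_eq_zero,
    or_iff_right (mul_ne_zero hσpow hτpow)]
  constructor <;> intro h <;> linarith
end
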